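/- Every reflection tree is a Sidorenko graph: if H is obtained from a tree T by applying reflection operations to a collection of subtrees of T, then t(H, W) ≥ (∫∫ W)^{|E(H)|} for every bounded symmetric measurable W : [0,1]² → ℝ≥0. -/

import Mathlib

open MeasureTheory Real unitInterval

open scoped Classical in
/-- A graph `H` is Sidorenko if `t(H, W) ≥ (∫∫ W)^{|E(H)|}` for every bounded
symmetric measurable `W : [0,1]² → ℝ≥0`. -/
def IsSidorenko {V : Type} [Fintype V] [DecidableEq V] (H : SimpleGraph V) : Prop :=
  ∀ (W : I → I → ℝ), Measurable (Function.uncurry W) → (∀ x y, 0 ≤ W x y) →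
    (∃ C : ℝ, ∀ x y, W x y ≤ C) → ∀ (hsym : ∀ x y, W x y = W y x),
    (∫ x : V → I, ∏ e ∈ H.edgeFinset,
        Sym2.lift ⟨fun a b => W (x a) (x b), fun a b => hsym (x a) (x b)⟩ e)
      ≥ (∫ u : I, ∫ v : I, W u v) ^ H.edgeFinset.card

/-- `IsReflectionTree V₀ T V H f` means that `H` (with the original tree `T` embedded in it
via `f`) is obtained from the tree `T` by finitely many reflection operations: each step
chooses a subtree of `T` spanned on `K`, an independent set `S ⊆ K`, and glues a fresh copy
of that subtree onto the current graph along `S`. -/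
inductive IsReflectionTree (V₀ : Type) (T : SimpleGraph V₀) :
    ∀ (V : Type), SimpleGraph V → (V₀ → V) → Prop
  | base : IsReflectionTree V₀ T V₀ T id
  | reflect (V : Type) (H : SimpleGraph V) (f : V₀ → V)
      (h : IsReflectionTree V₀ T V H f)
      (K S : Set V₀) (hSK : S ⊆ K)
      (hsubtree : (T.induce K).Connected)
      (hindep : ∀ u v, u ∈ S → v ∈ S → ¬ T.Adj u v)
      (V' : Type) (H' : SimpleGraph V') (i : V → V') (j : K → V')
      (hi : Function.Injective i) (hj : Function.Injective j)
      (hglue : ∀ v : K, (v : V₀) ∈ S → i (f v) = j v)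
      (hmeet : ∀ u (v : K), i u = j v → u = f v ∧ (v : V₀) ∈ S)
      (hcover : ∀ x : V', (∃ u, i u = x) ∨ (∃ v, j v = x))
      (hadj : ∀ x y : V', H'.Adj x y ↔
        ((∃ u v, i u = x ∧ i v = y ∧ H.Adj u v) ∨
          (∃ u v : K, j u = x ∧ j v = y ∧ T.Adj u v))) :
      IsReflectionTree V₀ T V' H' (fun v => i (f v))

namespace ReflectionTree

/-- A bounded measurable real function. -/
def BddMeas {α : Type*} [MeasurableSpace α] (F : α → ℝ) : Prop :=
  Measurable F ∧ ∃ C, ∀ x, |F x| ≤ C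

/-- A measurable real function with values in a compact subset of `(0, ∞)`. -/
def BddPos {α : Type*} [MeasurableSpace α] (F : α → ℝ) : Prop :=
  Measurable F ∧ ∃ c > 0, ∃ C, ∀ x, c ≤ F x ∧ F x ≤ C

section Functions

variable {α β : Type*} [MeasurableSpace α] [MeasurableSpace β] {F G : α → ℝ}

lemma BddMeas.integrable (h : BddMeas F) (μ : Measure α) [IsFiniteMeasure μ] :
    Integrable F μ := by
  obtain ⟨C, hC⟩ := h.2
  exact Integrable.of_bound h.1.aestronglyMeasurable C (ae_of_all _ hC)

lemma BddMeas.const (c : ℝ) : BddMeas (fun _ : α => c) :=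
  ⟨measurable_const, |c|, fun _ => le_rfl⟩

lemma BddMeas.add (hF : BddMeas F) (hG : BddMeas G) : BddMeas (fun x => F x + G x) := by
  obtain ⟨C, hC⟩ := hF.2
  obtain ⟨D, hD⟩ := hG.2
  exact ⟨hF.1.add hG.1, C + D, fun x => (abs_add_le _ _).trans (add_le_add (hC x) (hD x))⟩

lemma BddMeas.neg (hF : BddMeas F) : BddMeas (fun x => - F x) := by
  obtain ⟨C, hC⟩ := hF.2
  exact ⟨hF.1.neg, C, fun x => by simpa using hC x⟩

lemma BddMeas.sub (hF : BddMeas F) (hG : BddMeas G) : BddMeas (fun x => F x - G x) := by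
  simpa only [sub_eq_add_neg] using hF.add hG.neg

lemma BddMeas.mul (hF : BddMeas F) (hG : BddMeas G) : BddMeas (fun x => F x * G x) := by
  obtain ⟨C, hC⟩ := hF.2
  obtain ⟨D, hD⟩ := hG.2
  refine ⟨hF.1.mul hG.1, C * D, fun x => ?_⟩
  rw [abs_mul]
  exact mul_le_mul (hC x) (hD x) (abs_nonneg _) ((abs_nonneg _).trans (hC x))

lemma BddMeas.comp {τ : β → α} (hF : BddMeas F) (hτ : Measurable τ) :
    BddMeas (fun x => F (τ x)) :=
  ⟨hF.1.comp hτ, hF.2.imp fun _ h x => h (τ x)⟩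

lemma BddPos.pos (hF : BddPos F) (x : α) : 0 < F x := by
  obtain ⟨c, hc, C, h⟩ := hF.2
  exact hc.trans_le (h x).1

lemma BddPos.bddMeas (hF : BddPos F) : BddMeas F := by
  obtain ⟨c, hc, C, h⟩ := hF.2
  exact ⟨hF.1, C, fun x => by rw [abs_of_pos (hF.pos x)]; exact (h x).2⟩

lemma BddPos.one : BddPos (fun _ : α => (1 : ℝ)) :=
  ⟨measurable_const, 1, one_pos, 1, fun _ => ⟨le_rfl, le_rfl⟩⟩

lemma BddPos.mul (hF : BddPos F) (hG : BddPos G) : BddPos (fun x => F x * G x) := by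
  obtain ⟨c, hc, C, hC⟩ := hF.2
  obtain ⟨d, hd, D, hD⟩ := hG.2
  refine ⟨hF.1.mul hG.1, c * d, by positivity, C * D, fun x => ⟨?_, ?_⟩⟩
  · exact mul_le_mul (hC x).1 (hD x).1 hd.le (hF.pos x).le
  · exact mul_le_mul (hC x).2 (hD x).2 (hG.pos x).le ((hF.pos x).le.trans (hC x).2)

lemma BddPos.inv (hF : BddPos F) : BddPos (fun x => (F x)⁻¹) := by
  obtain ⟨c, hc, C, hC⟩ := hF.2
  rcases isEmpty_or_nonempty α with hα | ⟨⟨x₀⟩⟩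
  · exact ⟨hF.1.inv, 1, one_pos, 1, fun x => hα.elim x⟩
  have hCpos : 0 < C := (hF.pos x₀).trans_le (hC x₀).2
  exact ⟨hF.1.inv, C⁻¹, by positivity, c⁻¹, fun x =>
    ⟨inv_anti₀ (hF.pos x) (hC x).2, inv_anti₀ hc (hC x).1⟩⟩

lemma BddPos.div (hF : BddPos F) (hG : BddPos G) : BddPos (fun x => F x / G x) := by
  simpa only [div_eq_mul_inv] using hF.mul hG.inv

lemma BddPos.comp {τ : β → α} (hF : BddPos F) (hτ : Measurable τ) :
    BddPos (fun x => F (τ x)) := by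
  obtain ⟨c, hc, C, h⟩ := hF.2
  exact ⟨hF.1.comp hτ, c, hc, C, fun x => h (τ x)⟩

lemma BddPos.prod {ι : Type*} (s : Finset ι) {F : ι → α → ℝ} (h : ∀ i ∈ s, BddPos (F i)) :
    BddPos (fun x => ∏ i ∈ s, F i x) := by
  classical
  induction s using Finset.induction_on with
  | empty => simpa using BddPos.one (α := α)
  | insert a s ha ih =>
    simp only [Finset.prod_insert ha]
    exact (h a (by simp)).mul (ih fun i hi => h i (by simp [hi]))

lemma BddPos.log (hF : BddPos F) : BddMeas (fun x => Real.log (F x)) := by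
  obtain ⟨c, hc, C, h⟩ := hF.2
  refine ⟨hF.1.log, |Real.log c| + |Real.log C|, fun x => ?_⟩
  have h1 := Real.log_le_log hc (h x).1
  have h2 := Real.log_le_log (hF.pos x) (h x).2
  rw [abs_le]
  constructor
  · linarith [neg_abs_le (Real.log c), abs_nonneg (Real.log C)]
  · linarith [le_abs_self (Real.log C), abs_nonneg (Real.log c)]

lemma BddPos.integral_right {q : α × β → ℝ} (hq : BddPos q) (ν : Measure β)
    [IsProbabilityMeasure ν] : BddPos (fun a => ∫ b, q (a, b) ∂ν) := by
  obtain ⟨c, hc, C, h⟩ := hq.2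
  have hi (a : α) : Integrable (fun b => q (a, b)) ν :=
    (hq.comp measurable_prodMk_left).bddMeas.integrable ν
  refine ⟨(hq.1.stronglyMeasurable.integral_prod_right' (ν := ν)).measurable, c, hc, C,
    fun a => ⟨?_, ?_⟩⟩
  · simpa using integral_mono (integrable_const c) (hi a) fun b => (h (a, b)).1
  · simpa using integral_mono (hi a) (integrable_const C) fun b => (h (a, b)).2

lemma integral_mul_log_nonneg (μ : Measure α) [IsProbabilityMeasure μ] (hF : BddPos F)
    (h1 : ∫ x, F x ∂μ = 1) : 0 ≤ ∫ x, F x * Real.log (F x) ∂μ := by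
  have h : ∫ x, (F x - 1) ∂μ ≤ ∫ x, F x * Real.log (F x) ∂μ := by
    refine integral_mono ((hF.bddMeas.sub (.const 1)).integrable μ)
      ((hF.bddMeas.mul hF.log).integrable μ) fun x => ?_
    have hx := hF.pos x
    have := Real.one_sub_inv_le_log_of_pos hx
    have h2 := mul_le_mul_of_nonneg_left this hx.le
    rw [mul_sub, mul_one, mul_inv_cancel₀ hx.ne'] at h2
    exact h2
  rw [integral_sub (hF.bddMeas.integrable μ) (integrable_const 1)] at h
  simpa [h1] using h

/-- The Gibbs variational inequality. -/
lemma integral_mul_log_sub_log_le (μ : Measure α) [IsProbabilityMeasure μ] (hF : BddPos F)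
    (hG : BddPos G) (h1 : ∫ x, G x ∂μ = 1) :
    ∫ x, G x * (Real.log (F x) - Real.log (G x)) ∂μ ≤ Real.log (∫ x, F x ∂μ) := by
  set t := ∫ x, F x ∂μ with ht
  have htpos : 0 < t := by
    obtain ⟨c, hc, C, h⟩ := hF.2
    have : c ≤ t := by
      simpa using integral_mono (integrable_const c) (hF.bddMeas.integrable μ) fun b => (h b).1
    linarith
  have h : ∫ x, G x * (Real.log (F x) - Real.log (G x)) ∂μ
      ≤ ∫ x, (F x * t⁻¹ + G x * (Real.log t - 1)) ∂μ := by
    refine integral_mono ((hG.bddMeas.mul (hF.log.sub hG.log)).integrable μ)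
      (((hF.bddMeas.mul (.const _)).add (hG.bddMeas.mul (.const _))).integrable μ) fun x => ?_
    have hx := hG.pos x
    have hy := hF.pos x
    have := Real.log_le_sub_one_of_pos (x := F x / (G x * t)) (by positivity)
    rw [Real.log_div hy.ne' (by positivity), Real.log_mul hx.ne' htpos.ne'] at this
    have h2 := mul_le_mul_of_nonneg_left this hx.le
    have h3 : G x * (F x / (G x * t) - 1) = F x * t⁻¹ - G x := by field_simp
    simp only
    linarith
  rw [integral_add ((hF.bddMeas.mul (.const _)).integrable μ)
    ((hG.bddMeas.mul (.const _)).integrable μ), integral_mul_const, integral_mul_const, h1,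
    ← ht, mul_inv_cancel₀ htpos.ne'] at h
  linarith

end Functions

/-- Conditionally independent gluing of two densities along a common marginal does not decrease
the relative entropy functional. -/
lemma exists_glued_density {α β γ : Type*} [MeasurableSpace α] [MeasurableSpace β]
    [MeasurableSpace γ] (μ : Measure α) (ν : Measure β) (ρ : Measure γ)
    [IsProbabilityMeasure μ] [IsProbabilityMeasure ν] [IsProbabilityMeasure ρ]
    {τ : α → β} (hτ : Measurable τ) {g : α → ℝ} (hg : BddPos g) {q : β × γ → ℝ} (hq : BddPos q)
    (hq1 : ∫ b, q b ∂(ν.prod ρ) = 1)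
    (hmarg : ∀ Γ : β → ℝ, BddMeas Γ → ∫ a, Γ (τ a) * g a ∂μ = ∫ b, Γ b.1 * q b ∂(ν.prod ρ)) :
    ∃ g' : α × γ → ℝ, BddPos g' ∧
      (∀ F : α → ℝ, BddMeas F → ∫ p, F p.1 * g' p ∂(μ.prod ρ) = ∫ a, F a * g a ∂μ) ∧
      ∀ (φ : α → ℝ) (ψ : β × γ → ℝ), BddMeas φ → BddMeas ψ →
        ∫ a, (φ a - log (g a)) * g a ∂μ + ∫ b, (ψ b - log (q b)) * q b ∂(ν.prod ρ) ≤
          ∫ p, (φ p.1 + ψ (τ p.1, p.2) - log (g' p)) * g' p ∂(μ.prod ρ) := by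
  set r : β → ℝ := fun b => ∫ c, q (b, c) ∂ρ with hr_def
  have hr : BddPos r := hq.integral_right ρ
  have hτ' : Measurable (fun p : α × γ => (τ p.1, p.2)) := by fun_prop
  set g' : α × γ → ℝ := fun p => g p.1 * (q (τ p.1, p.2) / r (τ p.1)) with hg'_def
  have hg' : BddPos g' := (hg.comp measurable_fst).mul
    ((hq.comp hτ').div (hr.comp (hτ.comp measurable_fst)))
  have hfst (F : α → ℝ) (hF : BddMeas F) :
      ∫ p, F p.1 * g' p ∂(μ.prod ρ) = ∫ a, F a * g a ∂μ := by
    rw [integral_prod _ (((hF.comp measurable_fst).mul hg'.bddMeas).integrable _)]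
    congr 1 with a
    simp only [hg'_def]
    rw [integral_const_mul, integral_const_mul, integral_div]
    have : (∫ c, q (τ a, c) ∂ρ) / r (τ a) = 1 := div_self (hr.pos _).ne'
    rw [this, mul_one]
  have hβ (Γ : β → ℝ) (hΓ : BddMeas Γ) :
      ∫ b, Γ b.1 * q b ∂(ν.prod ρ) = ∫ b, Γ b * r b ∂ν := by
    rw [integral_prod _ (((hΓ.comp measurable_fst).mul hq.bddMeas).integrable _)]
    simp only [integral_const_mul, hr_def]
  have hsnd (G : β × γ → ℝ) (hG : BddMeas G) :
      ∫ p, G (τ p.1, p.2) * g' p ∂(μ.prod ρ) = ∫ b, G b * q b ∂(ν.prod ρ) := by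
    have hGq := hG.mul hq.bddMeas
    set Γ : β → ℝ := fun b => (∫ c, G (b, c) * q (b, c) ∂ρ) / r b with hΓ_def
    have hΓ : BddMeas Γ := by
      have h1 : BddMeas fun b => ∫ c, G (b, c) * q (b, c) ∂ρ := by
        obtain ⟨C, hC⟩ := hGq.2
        refine ⟨(hGq.1.stronglyMeasurable.integral_prod_right' (ν := ρ)).measurable, C,
          fun b => ?_⟩
        have := norm_integral_le_of_norm_le_const (μ := ρ) (f := fun c => G (b, c) * q (b, c))
          (C := C) (ae_of_all _ fun c => hC (b, c))
        simpa using this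
      simpa only [hΓ_def, div_eq_mul_inv] using h1.mul hr.inv.bddMeas
    rw [integral_prod _ (((hG.comp hτ').mul hg'.bddMeas).integrable _),
      integral_prod _ (hGq.integrable _)]
    have h1 := (hmarg Γ hΓ).trans (hβ Γ hΓ)
    have h2 (b : β) : Γ b * r b = ∫ c, G (b, c) * q (b, c) ∂ρ :=
      div_mul_cancel₀ _ (hr.pos b).ne'
    simp only [h2] at h1
    rw [← h1]
    congr 1 with a
    simp only [hΓ_def, hg'_def]
    rw [div_mul_eq_mul_div, mul_comm, ← integral_const_mul, ← integral_div]
    congr 1 with c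
    ring
  refine ⟨g', hg', hfst, fun φ ψ hφ hψ => ?_⟩
  have hrq : BddMeas fun b : β × γ => log (r b.1) := hr.log.comp measurable_fst
  have hlog (p : α × γ) : (φ p.1 + ψ (τ p.1, p.2) - log (g' p)) * g' p =
      (φ p.1 - log (g p.1)) * g' p +
        (ψ (τ p.1, p.2) - log (q (τ p.1, p.2)) + log (r (τ p.1))) * g' p := by
    have h1 := hg.pos p.1
    have h2 := hq.pos (τ p.1, p.2)
    have h3 := hr.pos (τ p.1)
    have : log (g' p) = log (g p.1) + (log (q (τ p.1, p.2)) - log (r (τ p.1))) := by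
      simp only [hg'_def]
      rw [log_mul h1.ne' (by positivity), log_div h2.ne' h3.ne']
    rw [this]
    ring
  have hφg := hφ.sub hg.log
  have hψq := hψ.sub hq.log
  simp only [hlog]
  rw [integral_add (((hφg.comp measurable_fst).mul hg'.bddMeas).integrable _)
    ((((hψq.add hrq).comp hτ').mul hg'.bddMeas).integrable _), hfst _ hφg,
    hsnd _ (hψq.add hrq)]
  have hsplit : ∫ b, (ψ b - log (q b) + log (r b.1)) * q b ∂(ν.prod ρ) =
      ∫ b, (ψ b - log (q b)) * q b ∂(ν.prod ρ) + ∫ b, r b * log (r b) ∂ν := by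
    simp only [add_mul]
    rw [integral_add ((hψq.mul hq.bddMeas).integrable _) ((hrq.mul hq.bddMeas).integrable _),
      hβ (fun b => log (r b)) hr.log]
    simp only [mul_comm]
  have hr1 : ∫ b, r b ∂ν = 1 := by
    rw [← hq1, integral_prod _ (hq.bddMeas.integrable _)]
  rw [hsplit]
  linarith [integral_mul_log_nonneg ν hr hr1]


section Splitting

variable {A B C : Type*}

/-- Splitting the coordinates indexed by `C` along a bijection `A ⊕ B → C`. -/
noncomputable def splitEquiv (i : A → C) (j : B → C) (h : Function.Bijective (Sum.elim i j)) :
    (C → I) ≃ᵐ (A → I) × (B → I) :=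
  (MeasurableEquiv.piCongrLeft (fun _ => I) (Equiv.ofBijective _ h)).symm.trans
    (MeasurableEquiv.sumPiEquivProdPi fun _ => I)

variable {i : A → C} {j : B → C} (h : Function.Bijective (Sum.elim i j))

lemma splitEquiv_symm_left (p : (A → I) × (B → I)) (a : A) :
    (splitEquiv i j h).symm p (i a) = p.1 a :=
  congrFun (congrArg Prod.fst ((splitEquiv i j h).apply_symm_apply p)) a

lemma splitEquiv_symm_right (p : (A → I) × (B → I)) (b : B) :
    (splitEquiv i j h).symm p (j b) = p.2 b :=
  congrFun (congrArg Prod.snd ((splitEquiv i j h).apply_symm_apply p)) b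

variable [Fintype A] [Fintype B] [Fintype C]

lemma measurePreserving_splitEquiv : MeasurePreserving (splitEquiv i j h) :=
  (volume_measurePreserving_sumPiEquivProdPi fun _ => I).comp
    (volume_measurePreserving_piCongrLeft (fun _ => I) (Equiv.ofBijective _ h)).symm

lemma integral_split (h : Function.Bijective (Sum.elim i j)) (F : (A → I) × (B → I) → ℝ) :
    ∫ x : C → I, F (fun a => x (i a), fun b => x (j b)) = ∫ p, F p :=
  (measurePreserving_splitEquiv h).integral_comp' F

lemma integral_glue (h : Function.Bijective (Sum.elim i j)) (F : (C → I) → ℝ) :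
    ∫ p, F ((splitEquiv i j h).symm p) = ∫ x, F x :=
  (measurePreserving_splitEquiv h).symm.integral_comp' F

lemma integral_comp_injective {i : A → C} (hi : Function.Injective i) (F : (A → I) → ℝ) :
    ∫ x : C → I, F (fun a => x (i a)) = ∫ y, F y := by
  classical
  have hb : Function.Bijective (Sum.elim i (Subtype.val : {c // c ∉ Set.range i} → C)) := by
    refine ⟨hi.sumElim Subtype.val_injective fun a b hab => b.2 ⟨a, hab⟩, fun c => ?_⟩
    by_cases hc : c ∈ Set.range i
    · obtain ⟨a, rfl⟩ := hc
      exact ⟨Sum.inl a, rfl⟩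
    · exact ⟨Sum.inr ⟨c, hc⟩, rfl⟩
  rw [integral_split hb (fun p => F p.1), Measure.volume_eq_prod, integral_fun_fst]
  simp

/-- Integrating out a coordinate on which only a stochastic kernel depends. -/
lemma integral_mul_kernel {u v : C} (huv : u ≠ v) {F : (C → I) → ℝ} (hF : BddMeas F)
    (hFv : ∀ x y : C → I, (∀ c ≠ v, x c = y c) → F x = F y) {N : I → I → ℝ}
    (hN : BddPos (Function.uncurry N)) (hN1 : ∀ a, ∫ t, N a t = 1) :
    ∫ x : C → I, F x * N (x u) (x v) = ∫ x, F x := by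
  classical
  have hb : Function.Bijective
      (Sum.elim (Subtype.val : {c // c ≠ v} → C) (fun _ : Unit => v)) := by
    refine ⟨Subtype.val_injective.sumElim (fun _ _ _ => rfl) fun a _ => a.2, fun c => ?_⟩
    by_cases hc : c = v
    · exact ⟨Sum.inr (), hc.symm⟩
    · exact ⟨Sum.inl ⟨c, hc⟩, rfl⟩
  set e := splitEquiv _ _ hb with he
  have hmeas : BddMeas fun p => F (e.symm p) := hF.comp e.symm.measurable
  have hNm : BddMeas fun p : ({c // c ≠ v} → I) × (Unit → I) => N (p.1 ⟨u, huv⟩) (p.2 ()) :=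
    (hN.comp (τ := fun p : ({c // c ≠ v} → I) × (Unit → I) => (p.1 ⟨u, huv⟩, p.2 ()))
      (by fun_prop)).bddMeas
  have h0 (y : {c // c ≠ v} → I) (z : Unit → I) : F (e.symm (y, z)) = F (e.symm (y, 0)) := by
    refine hFv _ _ fun c hc => ?_
    rw [he, splitEquiv_symm_left hb (y, z) ⟨c, hc⟩, splitEquiv_symm_left hb (y, 0) ⟨c, hc⟩]
  have hz (a : I) : ∫ z : Unit → I, N a (z ()) = 1 := by
    rw [← hN1 a]
    exact (volume_preserving_funUnique Unit I).integral_comp' (N a)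
  rw [← integral_glue hb, ← integral_glue hb, Measure.volume_eq_prod,
    integral_prod _ (hmeas.integrable _)]
  have h1 (p : ({c // c ≠ v} → I) × (Unit → I)) :
      F (e.symm p) * N (e.symm p u) (e.symm p v) =
        F (e.symm p) * N (p.1 ⟨u, huv⟩) (p.2 ()) := by
    rw [he, splitEquiv_symm_left hb p ⟨u, huv⟩, splitEquiv_symm_right hb p ()]
  simp only [← he, h1]
  rw [integral_prod _ ((hmeas.mul hNm).integrable _)]
  congr 1 with y
  simp only [h0 y]
  rw [integral_const_mul, hz]
  simp

end Splitting

section EdgeProducts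

variable (φ : I → I → ℝ) (hφ : ∀ a b, φ a b = φ b a)

/-- The factor that an edge contributes to a homomorphism density. -/
def edgeWeight {V : Type*} (x : V → I) : Sym2 V → ℝ :=
  Sym2.lift ⟨fun a b => φ (x a) (x b), fun a b => hφ (x a) (x b)⟩

open scoped Classical in
/-- The integrand of the homomorphism density of `H`. -/
noncomputable def edgeProd {V : Type*} [Fintype V] (H : SimpleGraph V) (x : V → I) : ℝ :=
  ∏ e ∈ H.edgeFinset, edgeWeight φ hφ x e

variable {φ}

lemma bddPos_edgeWeight {V : Type*} (h : BddPos (Function.uncurry φ)) (e : Sym2 V) :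
    BddPos (fun x : V → I => edgeWeight φ hφ x e) := by
  induction e with
  | h a b => exact h.comp (τ := fun x : V → I => (x a, x b)) (by fun_prop)

variable {V V' : Type*} [Fintype V] [Fintype V']

lemma edgeProd_eq (H : SimpleGraph V) [Fintype H.edgeSet] (x : V → I) :
    edgeProd φ hφ H x = ∏ e ∈ H.edgeFinset, edgeWeight φ hφ x e := by
  unfold edgeProd
  congr!

lemma bddPos_edgeProd (h : BddPos (Function.uncurry φ)) (H : SimpleGraph V) :
    BddPos (edgeProd φ hφ H) :=
  BddPos.prod _ fun e _ => bddPos_edgeWeight hφ h e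

lemma edgeProd_map (H : SimpleGraph V) (i : V ↪ V') (x : V' → I) :
    edgeProd φ hφ (H.map i) x = edgeProd φ hφ H (fun a => x (i a)) := by
  classical
  rw [edgeProd_eq, edgeProd_eq, SimpleGraph.edgeFinset_map, Finset.prod_map]
  refine Finset.prod_congr rfl fun e _ => ?_
  induction e with
  | h a b => rfl

lemma edgeProd_sup {H K : SimpleGraph V} (h : Disjoint H K) (x : V → I) :
    edgeProd φ hφ (H ⊔ K) x = edgeProd φ hφ H x * edgeProd φ hφ K x := by
  classical
  rw [edgeProd_eq, edgeProd_eq, edgeProd_eq, SimpleGraph.edgeFinset_sup,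
    Finset.prod_union (SimpleGraph.disjoint_edgeFinset.2 h)]

lemma edgeProd_edge {u v : V} (h : u ≠ v) (x : V → I) :
    edgeProd φ hφ (SimpleGraph.edge u v) x = φ (x u) (x v) := by
  classical
  have h : (SimpleGraph.edge u v).edgeFinset = {s(u, v)} := by
    ext e
    simp [SimpleGraph.edgeSet_edge_of_ne h]
  rw [edgeProd_eq, h, Finset.prod_singleton]
  rfl

lemma edgeProd_bot (x : V → I) : edgeProd φ hφ ⊥ x = 1 := by
  unfold edgeProd
  convert! Finset.prod_empty
  ext
  simp

open scoped Classical in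
lemma prod_edges_eq_prod_degree (H : SimpleGraph V) (d : I → ℝ) (x : V → I) :
    edgeProd (fun a b => d a * d b) (fun _ _ => mul_comm _ _) H x =
      ∏ v, d (x v) ^ H.degree v := by
  unfold edgeProd
  have h1 (e : Sym2 V) (he : e ∈ H.edgeFinset) :
      edgeWeight (fun a b => d a * d b) (fun _ _ => mul_comm _ _) x e =
        ∏ v, if v ∈ e then d (x v) else 1 := by
    induction e with
    | h a b =>
      have hab : a ≠ b := by simpa using (SimpleGraph.mem_edgeFinset.1 he).ne
      rw [← Finset.prod_filter]
      have : Finset.univ.filter (· ∈ s(a, b)) = {a, b} := by ext; simp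
      rw [this, Finset.prod_pair hab]
      rfl
  rw [Finset.prod_congr rfl h1, Finset.prod_comm]
  refine Finset.prod_congr rfl fun v _ => ?_
  rw [← Finset.prod_filter, Finset.prod_const, ← SimpleGraph.incidenceFinset_eq_filter,
    SimpleGraph.card_incidenceFinset_eq_degree]

end EdgeProducts

section TreeDensity

variable {V : Type*}

lemma exists_adj_connected_insert {T : SimpleGraph V} (hT : T.IsTree) {K : Set V}
    (hK : (T.induce K).Connected) (hne : K ≠ Set.univ) :
    ∃ u ∈ K, ∃ v ∉ K, T.Adj u v ∧ (T.induce (insert v K)).Connected ∧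
      ∀ u' ∈ K, T.Adj u' v → u' = u := by
  classical
  obtain ⟨b, hb⟩ := (Set.ne_univ_iff_exists_notMem K).1 hne
  obtain ⟨a⟩ := hK.nonempty
  obtain ⟨p⟩ := hT.1.preconnected a b
  obtain ⟨d, -, hu, hv⟩ := p.exists_boundary_dart K a.2 hb
  refine ⟨d.fst, hu, d.snd, hv, d.adj, ?_, fun u' hu' hadj => ?_⟩
  · have := SimpleGraph.connected_induce_union (G := T) (s := K) (t := {d.snd}) hK.preconnected
      (SimpleGraph.Preconnected.of_subsingleton) hu rfl d.adj
    rwa [Set.union_singleton] at this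
  · by_contra hne'
    obtain ⟨q⟩ := hK.preconnected ⟨u', hu'⟩ ⟨d.fst, hu⟩
    obtain ⟨P, hP⟩ : ∃ P : T.Path u' d.fst, ∀ y ∈ (P : T.Walk u' d.fst).support, y ∈ K := by
      refine ⟨q.toPath.map (SimpleGraph.Embedding.induce (G := T) K).toHom
        Subtype.val_injective, fun y hy => ?_⟩
      have hy' : y ∈ (q.toPath : (T.induce K).Walk ⟨u', hu'⟩ ⟨d.fst, hu⟩).support.map
          (SimpleGraph.Embedding.induce (G := T) K).toHom :=
        (SimpleGraph.Walk.support_map _ _) ▸ hy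
      obtain ⟨z, -, rfl⟩ := List.mem_map.1 hy'
      exact z.2
    set r : T.Path u' d.fst :=
      ⟨.cons hadj (.cons d.adj.symm .nil), by simp [hadj.ne, hne', d.adj.ne']⟩ with hr
    have := hT.2.subsingleton_path u' d.fst
    refine hv (hP _ ?_)
    rw [Subsingleton.elim P r]
    simp [hr]

variable (w : I → I → ℝ)

/-- The degree function of a kernel. -/
noncomputable def degree (a : I) : ℝ := ∫ b, w a b

/-- The kernel `w` normalised by the degrees of both arguments. -/
noncomputable def normKernel (a b : I) : ℝ := w a b / (degree w a * degree w b)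

variable {w} (hw : ∀ a b, w a b = w b a)

include hw in
lemma normKernel_symm (a b : I) : normKernel w a b = normKernel w b a := by
  rw [normKernel, normKernel, hw, mul_comm]

/-- The density of the tree-indexed random walk with edge distribution `w`. -/
noncomputable def treeDensity [Fintype V] (T : SimpleGraph V) (x : V → I) : ℝ :=
  edgeProd (normKernel w) (normKernel_symm hw) T x * ∏ v, degree w (x v)

variable (hpos : BddPos (Function.uncurry w)) (h1 : ∫ a, ∫ b, w a b = 1)

include hpos in
lemma bddPos_degree : BddPos (degree w) := hpos.integral_right volume

include hpos in
lemma bddPos_normKernel : BddPos (Function.uncurry (normKernel w)) :=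
  hpos.div (((bddPos_degree hpos).comp measurable_fst).mul
    ((bddPos_degree hpos).comp measurable_snd))

include hpos in
lemma bddPos_treeDensity [Fintype V] (T : SimpleGraph V) : BddPos (treeDensity hw T) :=
  (bddPos_edgeProd _ (bddPos_normKernel hpos) T).mul
    (BddPos.prod _ fun v _ => (bddPos_degree hpos).comp (measurable_pi_apply v))

include hpos in
lemma integral_normKernel_mul_degree (a : I) : ∫ t, normKernel w a t * degree w t = 1 := by
  have hd := (bddPos_degree hpos).pos
  have h (t : I) : normKernel w a t * degree w t = w a t / degree w a := by
    have := (hd t).ne'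
    have := (hd a).ne'
    rw [normKernel]
    field_simp
  simp only [h]
  rw [integral_div]
  exact div_self (hd a).ne'

open scoped Classical in
lemma treeDensity_insert [Fintype V] {T : SimpleGraph V} {K K' : Set V} {u v : V}
    (hK' : ∀ a, a ∈ K' ↔ a = v ∨ a ∈ K) (hu : u ∈ K)
    (hv : v ∉ K) (huv : T.Adj u v) (huniq : ∀ u' ∈ K, T.Adj u' v → u' = u) (x : V → I) :
    treeDensity hw (T.induce K') (fun a => x a) =
      treeDensity hw (T.induce K) (fun a => x a) *
        (normKernel w (x u) (x v) * degree w (x v)) := by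
  have hmap : (T.induce K').map (Function.Embedding.subtype _) =
      (T.induce K).map (Function.Embedding.subtype _) ⊔ SimpleGraph.edge u v := by
    ext a b
    simp only [SimpleGraph.map_adj, SimpleGraph.sup_adj, SimpleGraph.edge_adj,
      SimpleGraph.comap_adj, Function.Embedding.subtype_apply, Subtype.exists]
    constructor
    · rintro ⟨a, ha, b, hb, hab, rfl, rfl⟩
      rcases (hK' _).1 ha with rfl | ha
      · rcases (hK' _).1 hb with rfl | hb
        · exact (hab.ne rfl).elim
        · exact Or.inr ⟨Or.inr ⟨rfl, huniq b hb hab.symm⟩, hab.ne⟩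
      · rcases (hK' _).1 hb with rfl | hb
        · exact Or.inr ⟨Or.inl ⟨huniq a ha hab, rfl⟩, hab.ne⟩
        · exact Or.inl ⟨a, ha, b, hb, hab, rfl, rfl⟩
    · rintro (⟨a, ha, b, hb, hab, rfl, rfl⟩ | ⟨⟨rfl, rfl⟩ | ⟨rfl, rfl⟩, -⟩)
      · exact ⟨a, (hK' _).2 (Or.inr ha), b, (hK' _).2 (Or.inr hb), hab, rfl, rfl⟩
      · exact ⟨_, (hK' _).2 (Or.inr hu), _, (hK' _).2 (Or.inl rfl), huv, rfl, rfl⟩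
      · exact ⟨_, (hK' _).2 (Or.inl rfl), _, (hK' _).2 (Or.inr hu), huv.symm, rfl, rfl⟩
  have hdisj : Disjoint ((T.induce K).map (Function.Embedding.subtype _))
      (SimpleGraph.edge u v) := by
    rw [disjoint_iff]
    ext a b
    simp only [SimpleGraph.map_adj, SimpleGraph.inf_adj, SimpleGraph.edge_adj,
      SimpleGraph.comap_adj, Function.Embedding.subtype_apply, Subtype.exists,
      SimpleGraph.bot_adj, iff_false]
    rintro ⟨⟨a, ha, b, hb, hab, rfl, rfl⟩, ⟨rfl, rfl⟩ | ⟨rfl, rfl⟩, -⟩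
    · exact hv hb
    · exact hv ha
  have hedge := edgeProd_map (normKernel_symm hw) (T.induce K')
    (Function.Embedding.subtype _) x
  rw [hmap, edgeProd_sup _ hdisj, edgeProd_edge _ huv.ne, edgeProd_map] at hedge
  simp only [Function.Embedding.subtype_apply] at hedge
  have hprod : ∏ a : K', degree w (x a) =
      degree w (x v) * ∏ a : K, degree w (x a) := by
    rw [← Finset.prod_subtype (insert v K.toFinset) (by simp [hK']) fun a => degree w (x a),
      Finset.prod_insert (by simpa using hv),
      Finset.prod_subtype (p := (· ∈ K)) K.toFinset (by simp) fun a => degree w (x a)]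
  rw [treeDensity, treeDensity, ← hedge, hprod]
  ring

open scoped Classical in
include hpos in
/-- The tree-indexed random walk restricts to the tree-indexed random walk on a subtree. -/
lemma integral_mul_treeDensity_induce [Fintype V] {T : SimpleGraph V} (hT : T.IsTree) (K : Set V)
    (hK : (T.induce K).Connected) {G : (V → I) → ℝ} (hG : BddMeas G) (hGK : DependsOn G K) :
    ∫ x, G x * treeDensity hw T x = ∫ x, G x * treeDensity hw (T.induce K) (fun a => x a) := by
  induction hn : Kᶜ.ncard generalizing K with
  | zero =>
    have hKu : ∀ a, a ∈ K := by
      rwa [Set.ncard_eq_zero, Set.compl_empty_iff, Set.eq_univ_iff_forall] at hn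
    congr 1 with x
    have hedge := edgeProd_map (normKernel_symm hw) (T.induce K) (Function.Embedding.subtype _) x
    have hmap : (T.induce K).map (Function.Embedding.subtype _) = T := by
      ext a b
      simp only [SimpleGraph.map_adj, SimpleGraph.comap_adj, Function.Embedding.subtype_apply,
        Subtype.exists]
      exact ⟨by rintro ⟨a, _, b, _, h, rfl, rfl⟩; exact h,
        fun h => ⟨a, hKu a, b, hKu b, h, rfl, rfl⟩⟩
    rw [hmap] at hedge
    rw [treeDensity, treeDensity, hedge,
      Finset.prod_subtype (p := (· ∈ K)) Finset.univ (by simp [hKu]) fun a => degree w (x a)]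
    rfl
  | succ n ih =>
    have hne : K ≠ Set.univ := by
      rintro rfl
      simp at hn
    obtain ⟨u, hu, v, hv, huv, hconn, huniq⟩ := exists_adj_connected_insert hT hK hne
    have hcard : (insert v K)ᶜ.ncard = n := by
      have : (insert v K)ᶜ = Kᶜ \ {v} := by ext; simp [not_or, and_comm]
      rw [this, Set.ncard_sdiff_singleton_of_mem (by simpa using hv), hn]
      rfl
    rw [ih _ hconn (hGK.mono (Set.subset_insert v K)) hcard]
    simp only [treeDensity_insert hw (fun _ => Set.mem_insert_iff) hu hv huv huniq, ← mul_assoc]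
    simp only [mul_assoc _ (normKernel w _ _)]
    refine integral_mul_kernel huv.ne
      (F := fun x => G x * treeDensity hw (T.induce K) (fun a => x a))
      (N := fun a b => normKernel w a b * degree w b)
      (hG.mul ((bddPos_treeDensity hw hpos _).comp (by fun_prop)).bddMeas) (fun x y hxy => ?_)
      ((bddPos_normKernel hpos).mul ((bddPos_degree hpos).comp measurable_snd))
      (integral_normKernel_mul_degree hpos)
    have hxy' : ∀ a ∈ K, x a = y a := fun a ha => hxy a (by rintro rfl; exact hv ha)
    have : (fun a : K => x a) = fun a : K => y a := funext fun a => hxy' a a.2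
    rw [hGK hxy', this]

include hpos in
lemma integral_mul_treeDensity_vertex [Fintype V] {T : SimpleGraph V} (hT : T.IsTree) (v : V)
    {F : I → ℝ} (hF : BddMeas F) :
    ∫ x, F (x v) * treeDensity hw T x = ∫ t, F t * degree w t := by
  classical
  obtain ⟨K, hK⟩ : ∃ K : Set V, ∀ a, a ∈ K ↔ a = v := ⟨{v}, fun _ => Iff.rfl⟩
  have : Subsingleton K := ⟨fun a b => Subtype.ext (by rw [(hK _).1 a.2, (hK _).1 b.2])⟩
  have hconn : (T.induce K).Connected := by
    rw [SimpleGraph.connected_iff]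
    exact ⟨.of_subsingleton, ⟨⟨v, (hK v).2 rfl⟩⟩⟩
  rw [integral_mul_treeDensity_induce hw hpos hT K hconn
    (G := fun x => F (x v)) (hF.comp (measurable_pi_apply v))
    (fun x y h => by simp only [h v ((hK v).2 rfl)])]
  have h (x : V → I) : treeDensity hw (T.induce K) (fun a => x a) = degree w (x v) := by
    have hbot : T.induce K = ⊥ := Subsingleton.elim _ _
    rw [treeDensity, hbot, edgeProd_bot, one_mul,
      ← Finset.prod_subtype {v} (by simp [hK]) fun a => degree w (x a), Finset.prod_singleton]
  simp only [h]
  exact integral_comp_injective (i := fun _ : Unit => v) (fun _ _ _ => rfl)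
    (fun y => F (y ()) * degree w (y ())) |>.trans
      ((volume_preserving_funUnique Unit I).integral_comp' fun t => F t * degree w t)

include h1 hpos in
lemma integral_treeDensity [Fintype V] {T : SimpleGraph V} (hT : T.IsTree) :
    ∫ x, treeDensity hw T x = 1 := by
  obtain ⟨v⟩ := hT.1.nonempty
  have := integral_mul_treeDensity_vertex hw hpos hT v (.const 1)
  simp only [one_mul] at this
  exact this.trans h1

include h1 hpos in
/-- The entropy bound for a nontrivial tree. -/
lemma treeDensity_entropy [Fintype V] [Nontrivial V] {T : SimpleGraph V} (hT : T.IsTree) :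
    0 ≤ ∫ x, (log (edgeProd w hw T x) - log (treeDensity hw T x)) * treeDensity hw T x := by
  classical
  have hd := bddPos_degree hpos
  have hlog (x : V → I) : log (edgeProd w hw T x) - log (treeDensity hw T x) =
      ∑ v, ((T.degree v : ℝ) - 1) * log (degree w (x v)) := by
    have hM := (bddPos_edgeProd (normKernel_symm hw) (bddPos_normKernel hpos) T).pos x
    have hfac : edgeProd w hw T x = edgeProd (normKernel w) (normKernel_symm hw) T x *
        ∏ v, degree w (x v) ^ T.degree v := by
      have := prod_edges_eq_prod_degree T (degree w) x
      rw [← show _ = ∏ v, degree w (x v) ^ T.degree v by convert! this]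
      unfold edgeProd
      rw [← Finset.prod_mul_distrib]
      refine Finset.prod_congr rfl fun e _ => ?_
      induction e with
      | h a b =>
        exact (div_mul_cancel₀ _ (mul_pos (hd.pos _) (hd.pos _)).ne').symm
    have hp1 : (∏ v, degree w (x v) ^ T.degree v) ≠ 0 :=
      Finset.prod_ne_zero_iff.2 fun v _ => (pow_pos (hd.pos _) _).ne'
    have hp2 : (∏ v, degree w (x v)) ≠ 0 := Finset.prod_ne_zero_iff.2 fun v _ => (hd.pos _).ne'
    rw [hfac, treeDensity, log_mul hM.ne' hp1, log_mul hM.ne' hp2,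
      log_prod fun v _ => (pow_pos (hd.pos _) _).ne', log_prod fun v _ => (hd.pos _).ne',
      add_sub_add_left_eq_sub, ← Finset.sum_sub_distrib]
    refine Finset.sum_congr rfl fun v _ => ?_
    rw [log_pow]
    ring
  simp only [hlog, Finset.sum_mul, mul_assoc]
  have hlogd (v : V) : BddMeas fun x : V → I => log (degree w (x v)) :=
    hd.log.comp (measurable_pi_apply v)
  rw [integral_finsetSum _ fun v _ => (((BddMeas.const _).mul
    ((hlogd v).mul (bddPos_treeDensity hw hpos T).bddMeas)).integrable _)]
  refine Finset.sum_nonneg fun v _ => ?_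
  rw [integral_const_mul, integral_mul_treeDensity_vertex hw hpos hT v hd.log]
  have hdeg : 1 ≤ T.degree v := hT.1.preconnected.degree_pos_of_nontrivial v
  refine mul_nonneg (sub_nonneg.2 (by exact_mod_cast hdeg)) ?_
  simpa only [mul_comm] using integral_mul_log_nonneg volume hd h1

end TreeDensity

section Reflection

variable {V₀ V V' : Type*} [Fintype V] [Fintype V'] {w : I → I → ℝ} (hw : ∀ a b, w a b = w b a)

lemma edgeProd_reflect {T : SimpleGraph V₀} {H : SimpleGraph V} {H' : SimpleGraph V'}
    {f : V₀ → V} {K S : Set V₀} [Fintype K]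
    (hindep : ∀ u v, u ∈ S → v ∈ S → ¬ T.Adj u v) {i : V → V'} {j : K → V'}
    (hi : Function.Injective i) (hj : Function.Injective j)
    (hmeet : ∀ u (v : K), i u = j v → u = f v ∧ (v : V₀) ∈ S)
    (hadj : ∀ x y : V', H'.Adj x y ↔
      ((∃ u v, i u = x ∧ i v = y ∧ H.Adj u v) ∨
        (∃ u v : K, j u = x ∧ j v = y ∧ T.Adj u v))) (x : V' → I) :
    edgeProd w hw H' x =
      edgeProd w hw H (fun a => x (i a)) * edgeProd w hw (T.induce K) (fun a => x (j a)) := by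
  have hsup : H' = H.map (⟨i, hi⟩ : V ↪ V') ⊔ (T.induce K).map (⟨j, hj⟩ : K ↪ V') := by
    ext a b
    rw [hadj, SimpleGraph.sup_adj, SimpleGraph.map_adj, SimpleGraph.map_adj]
    constructor
    · rintro (⟨u, v, hu, hv, huv⟩ | ⟨u, v, hu, hv, huv⟩)
      exacts [Or.inl ⟨u, v, huv, hu, hv⟩, Or.inr ⟨u, v, huv, hu, hv⟩]
    · rintro (⟨u, v, huv, hu, hv⟩ | ⟨u, v, huv, hu, hv⟩)
      exacts [Or.inl ⟨u, v, hu, hv, huv⟩, Or.inr ⟨u, v, hu, hv, huv⟩]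
  have hdisj : Disjoint (H.map (⟨i, hi⟩ : V ↪ V')) ((T.induce K).map (⟨j, hj⟩ : K ↪ V')) := by
    rw [disjoint_iff]
    ext a b
    rw [SimpleGraph.inf_adj, SimpleGraph.map_adj, SimpleGraph.map_adj, SimpleGraph.bot_adj,
      iff_false]
    rintro ⟨⟨u, v, -, rfl, rfl⟩, u', v', hadj', hu, hv⟩
    exact hindep _ _ (hmeet _ _ hu.symm).2 (hmeet _ _ hv.symm).2 hadj'
  rw [hsup, edgeProd_sup _ hdisj, edgeProd_map, edgeProd_map]
  rfl

variable (hpos : BddPos (Function.uncurry w))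

include hpos in
lemma exists_reflected_density [Fintype V₀] {T : SimpleGraph V₀} {H : SimpleGraph V}
    {H' : SimpleGraph V'}
    {f : V₀ → V} {K S : Set V₀} [Fintype K]
    (hindep : ∀ u v, u ∈ S → v ∈ S → ¬ T.Adj u v) {i : V → V'} {j : K → V'}
    (hi : Function.Injective i) (hj : Function.Injective j)
    (hglue : ∀ v : K, (v : V₀) ∈ S → i (f v) = j v)
    (hmeet : ∀ u (v : K), i u = j v → u = f v ∧ (v : V₀) ∈ S)
    (hcover : ∀ x : V', (∃ u, i u = x) ∨ (∃ v, j v = x))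
    (hadj : ∀ x y : V', H'.Adj x y ↔
      ((∃ u v, i u = x ∧ i v = y ∧ H.Adj u v) ∨
        (∃ u v : K, j u = x ∧ j v = y ∧ T.Adj u v)))
    {gT : (V₀ → I) → ℝ} {g : (V → I) → ℝ} {gK : (K → I) → ℝ} (hg : BddPos g) (hgK : BddPos gK)
    (hgT1 : ∫ y, gT y = 1)
    (hmarg : ∀ G : (V₀ → I) → ℝ, BddMeas G →
      ∫ x, G (fun a => x (f a)) * g x = ∫ y, G y * gT y)
    (hmargK : ∀ G : (K → I) → ℝ, BddMeas G →
      ∫ y, G (fun a => y a) * gT y = ∫ z, G z * gK z)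
    (hΦ : 0 ≤ ∫ x, (log (edgeProd w hw H x) - log (g x)) * g x)
    (hΦK : 0 ≤ ∫ x, (log (edgeProd w hw (T.induce K) x) - log (gK x)) * gK x) :
    ∃ g' : (V' → I) → ℝ, BddPos g' ∧
      (∀ F : (V → I) → ℝ, BddMeas F → ∫ x, F (fun a => x (i a)) * g' x = ∫ y, F y * g y) ∧
      0 ≤ ∫ x, (log (edgeProd w hw H' x) - log (g' x)) * g' x := by
  classical
  have hb : Function.Bijective
      (Sum.elim i (fun v : {v : K // (v : V₀) ∉ S} => j v)) := by
    refine ⟨hi.sumElim (hj.comp Subtype.val_injective) fun a b hab => b.2 (hmeet _ _ hab).2,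
      fun x => ?_⟩
    rcases hcover x with ⟨u, rfl⟩ | ⟨v, rfl⟩
    · exact ⟨Sum.inl u, rfl⟩
    · by_cases hv : (v : V₀) ∈ S
      · exact ⟨Sum.inl (f v), hglue v hv⟩
      · exact ⟨Sum.inr ⟨v, hv⟩, rfl⟩
  have hbK : Function.Bijective (Sum.elim (Subtype.val : {v : K // (v : V₀) ∈ S} → K)
      (Subtype.val : {v : K // (v : V₀) ∉ S} → K)) := by
    refine ⟨Subtype.val_injective.sumElim Subtype.val_injective
      fun a b hab => b.2 (hab ▸ a.2), fun v => ?_⟩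
    by_cases hv : (v : V₀) ∈ S
    · exact ⟨Sum.inl ⟨v, hv⟩, rfl⟩
    · exact ⟨Sum.inr ⟨v, hv⟩, rfl⟩
  set e := splitEquiv _ _ hb with he
  set eK := splitEquiv _ _ hbK with heK
  set τ : (V → I) → ({v : K // (v : V₀) ∈ S} → I) := fun x s => x (f s.1) with hτ_def
  have hτ : Measurable τ := by fun_prop
  have hrestr (p) : (fun s : {v : K // (v : V₀) ∈ S} => eK.symm p s.1) = p.1 :=
    funext fun s => splitEquiv_symm_left hbK p s
  have hgK1 : ∫ z, gK z = 1 := by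
    have := hmargK _ (.const 1)
    simp only [one_mul] at this
    rw [← this, hgT1]
  obtain ⟨g'', hg'', hfst, hent⟩ := exists_glued_density volume volume volume hτ hg
    (hgK.comp eK.symm.measurable) ((integral_glue hbK gK).trans hgK1) (fun Γ hΓ => by
      have h1 := hmarg (fun y => Γ fun s : {v : K // (v : V₀) ∈ S} => y s.1)
        (hΓ.comp (by fun_prop))
      have h2 := hmargK (fun y => Γ fun s : {v : K // (v : V₀) ∈ S} => y s.1)
        (hΓ.comp (by fun_prop))
      rw [← integral_glue hbK] at h2
      simp only [← heK, hrestr] at h2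
      exact h1.trans h2)
  have hsplit (F : (V → I) × ({v : K // (v : V₀) ∉ S} → I) → ℝ) :
      ∫ x, F (e x) = ∫ p, F p := integral_split hb F
  refine ⟨fun x => g'' (e x), hg''.comp e.measurable, fun F hF => ?_, ?_⟩
  · rw [← hfst F hF]
    exact hsplit fun p => F p.1 * g'' p
  · have hφ := (bddPos_edgeProd hw hpos H).log
    have hψ := ((bddPos_edgeProd hw hpos (T.induce K)).comp eK.symm.measurable).log
    have hlog (x : V' → I) : log (edgeProd w hw H' x) = log (edgeProd w hw H (e x).1) +
        log (edgeProd w hw (T.induce K) (eK.symm (τ (e x).1, (e x).2))) := by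
      have hx : eK.symm (τ (e x).1, (e x).2) = fun a => x (j a) := by
        rw [MeasurableEquiv.symm_apply_eq]
        refine Prod.ext (funext fun s => ?_) rfl
        exact congrArg x (hglue s.1 s.2)
      rw [edgeProd_reflect hw hindep hi hj hmeet hadj, hx,
        log_mul ((bddPos_edgeProd hw hpos H).pos _).ne'
          ((bddPos_edgeProd hw hpos (T.induce K)).pos _).ne']
      rfl
    simp only [hlog]
    refine le_trans ?_ ((hent _ _ hφ hψ).trans_eq (hsplit fun p =>
      (log (edgeProd w hw H p.1) + log (edgeProd w hw (T.induce K) (eK.symm (τ p.1, p.2))) -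
        log (g'' p)) * g'' p).symm)
    refine add_nonneg hΦ (hΦK.trans_eq ?_)
    exact (integral_glue hbK fun z =>
      (log (edgeProd w hw (T.induce K) z) - log (gK z)) * gK z).symm

end Reflection

lemma injective_of_isReflectionTree {V₀ : Type} {T : SimpleGraph V₀} {V : Type}
    {H : SimpleGraph V} {f : V₀ → V} (h : IsReflectionTree V₀ T V H f) :
    Function.Injective f := by
  induction h with
  | base => exact Function.injective_id
  | reflect _ _ _ _ _ _ _ _ _ _ _ _ _ hi _ _ _ _ _ ih => exact hi.comp ih

section Sidorenko

variable {w : I → I → ℝ} (hw : ∀ a b, w a b = w b a) (hpos : BddPos (Function.uncurry w))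

include hpos in
lemma exists_density_of_isReflectionTree {V₀ : Type} [hV₀ : Fintype V₀] {T : SimpleGraph V₀}
    {gT : (V₀ → I) → ℝ} (hgT : BddPos gT) (hgT1 : ∫ y, gT y = 1)
    (hΦT : 0 ≤ ∫ x, (log (edgeProd w hw T x) - log (gT x)) * gT x)
    (hsub : ∀ (K : Set V₀) [Fintype K], (T.induce K).Connected → Nontrivial K →
      ∃ gK : (K → I) → ℝ, BddPos gK ∧
        (∀ G : (K → I) → ℝ, BddMeas G → ∫ y, G (fun a => y a) * gT y = ∫ z, G z * gK z) ∧
        0 ≤ ∫ x, (log (edgeProd w hw (T.induce K) x) - log (gK x)) * gK x)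
    {V : Type} {H : SimpleGraph V} {f : V₀ → V} (h : IsReflectionTree V₀ T V H f) :
    ∀ [Fintype V], ∃ g : (V → I) → ℝ, BddPos g ∧
      (∀ G : (V₀ → I) → ℝ, BddMeas G → ∫ x, G (fun a => x (f a)) * g x = ∫ y, G y * gT y) ∧
      0 ≤ ∫ x, (log (edgeProd w hw H x) - log (g x)) * g x := by
  induction h with
  | base =>
    intro hV
    obtain rfl := Subsingleton.elim hV hV₀
    exact ⟨gT, hgT, fun G _ => rfl, hΦT⟩
  | reflect V H f h K S hSK hconn hindep V' H' i j hi hj hglue hmeet hcover hadj ih =>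
    intro hV'
    classical
    have : Fintype V := Fintype.ofInjective i hi
    obtain ⟨g, hg, hmarg, hΦ⟩ := ih
    suffices hs : ∃ g' : (V' → I) → ℝ, BddPos g' ∧
        (∀ F : (V → I) → ℝ, BddMeas F → ∫ x, F (fun a => x (i a)) * g' x = ∫ y, F y * g y) ∧
        0 ≤ ∫ x, (log (edgeProd w hw H' x) - log (g' x)) * g' x by
      obtain ⟨g', hg', hmarg', hΦ'⟩ := hs
      exact ⟨g', hg', fun G hG => (hmarg' (fun y => G fun a => y (f a))
        (hG.comp (by fun_prop))).trans (hmarg G hG), hΦ'⟩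
    rcases subsingleton_or_nontrivial K with hsK | hK
    · refine ⟨fun x => g fun a => x (i a), hg.comp (by fun_prop), fun F _ =>
        integral_comp_injective hi fun y => F y * g y, ?_⟩
      have hbot : T.induce K = ⊥ := Subsingleton.elim _ _
      simp only [edgeProd_reflect hw hindep hi hj hmeet hadj, hbot, edgeProd_bot, mul_one]
      exact hΦ.trans_eq (integral_comp_injective hi fun y =>
        (log (edgeProd w hw H y) - log (g y)) * g y).symm
    · obtain ⟨gK, hgK, hmargK, hΦK⟩ := hsub K hconn hK
      exact exists_reflected_density hw hpos hindep hi hj hglue hmeet hcover hadj hg hgK hgT1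
        hmarg hmargK hΦ hΦK

include hpos in
lemma one_le_integral_edgeProd (h1 : ∫ a, ∫ b, w a b = 1) {V₀ : Type} {T : SimpleGraph V₀}
    (hT : T.IsTree) {V : Type} [Fintype V] {H : SimpleGraph V} {f : V₀ → V}
    (h : IsReflectionTree V₀ T V H f) : 1 ≤ ∫ x, edgeProd w hw H x := by
  classical
  have : Fintype V₀ := Fintype.ofInjective f (injective_of_isReflectionTree h)
  obtain ⟨g, hg, hg1, hΦ⟩ : ∃ g : (V → I) → ℝ, BddPos g ∧ ∫ x, g x = 1 ∧
      0 ≤ ∫ x, (log (edgeProd w hw H x) - log (g x)) * g x := by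
    suffices hs : ∃ gT : (V₀ → I) → ℝ, ∃ g : (V → I) → ℝ, ∫ y, gT y = 1 ∧ BddPos g ∧
        (∀ G : (V₀ → I) → ℝ, BddMeas G →
          ∫ x, G (fun a => x (f a)) * g x = ∫ y, G y * gT y) ∧
        0 ≤ ∫ x, (log (edgeProd w hw H x) - log (g x)) * g x by
      obtain ⟨gT, g, hgT1, hg, hmarg, hΦ⟩ := hs
      refine ⟨g, hg, ?_, hΦ⟩
      have := hmarg _ (.const 1)
      simp only [one_mul] at this
      rw [this, hgT1]
    rcases subsingleton_or_nontrivial V₀ with hs | hn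
    · have hbot : T = ⊥ := Subsingleton.elim _ _
      refine ⟨fun _ => 1, ?_⟩
      obtain ⟨g, hg⟩ := exists_density_of_isReflectionTree hw hpos (gT := fun _ => 1) .one
        (by simp) (by simp [hbot, edgeProd_bot]) (fun K _ _ hK => by
          obtain ⟨a, b, hab⟩ := hK
          exact (hab (Subsingleton.elim _ _)).elim) h
      exact ⟨g, by simp, hg⟩
    · refine ⟨treeDensity hw T, ?_⟩
      obtain ⟨g, hg⟩ := exists_density_of_isReflectionTree hw hpos
        (bddPos_treeDensity hw hpos T) (integral_treeDensity hw hpos h1 hT)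
        (treeDensity_entropy hw hpos h1 hT) (fun K hfK hconn hK => by
          have hTK : (T.induce K).IsTree := ⟨hconn, hT.2.induce K⟩
          refine ⟨treeDensity hw (T.induce K), bddPos_treeDensity hw hpos _, fun G hG => ?_,
            treeDensity_entropy hw hpos h1 hTK⟩
          rw [integral_mul_treeDensity_induce hw hpos hT K hconn
            (G := fun y => G fun a => y a) (hG.comp (by fun_prop))
            (fun x y hxy => congrArg G (funext fun a => hxy a a.2))]
          convert! integral_comp_injective (i := (Subtype.val : K → V₀)) Subtype.val_injective
            fun z => G z * treeDensity hw (T.induce K) z) h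
      exact ⟨g, integral_treeDensity hw hpos h1 hT, hg⟩
  have hlog := integral_mul_log_sub_log_le volume (bddPos_edgeProd hw hpos H) hg hg1
  simp only [mul_comm (g _)] at hlog
  have hnn : 0 ≤ ∫ x, edgeProd w hw H x :=
    integral_nonneg fun x => ((bddPos_edgeProd hw hpos H).pos x).le
  by_contra! hlt
  have h0 : ∫ x, edgeProd w hw H x ≠ 0 := by
    obtain ⟨-, c, hc, C, hC⟩ := bddPos_edgeProd hw hpos H
    have := integral_mono (integrable_const c)
      ((bddPos_edgeProd hw hpos H).bddMeas.integrable volume) fun x => (hC x).1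
    simp only [integral_const, probReal_univ, one_smul] at this
    linarith
  linarith [Real.log_neg (lt_of_le_of_ne hnn h0.symm) hlt]

open scoped Classical in
include hpos in
lemma pow_le_integral_edgeProd {V₀ : Type} {T : SimpleGraph V₀}
    (hT : T.IsTree) {V : Type} [Fintype V] {H : SimpleGraph V} {f : V₀ → V}
    (h : IsReflectionTree V₀ T V H f) :
    (∫ a, ∫ b, w a b) ^ H.edgeFinset.card ≤ ∫ x, edgeProd w hw H x := by
  set p := ∫ a, ∫ b, w a b with hp
  have hppos : 0 < p := by
    obtain ⟨-, c, hc, C, hC⟩ := bddPos_degree hpos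
    have := integral_mono (integrable_const c)
      ((bddPos_degree hpos).bddMeas.integrable volume) fun x => (hC x).1
    simp only [integral_const, probReal_univ, one_smul] at this
    exact hc.trans_le this
  have hpp : BddPos fun _ : I × I => p := ⟨measurable_const, p, hppos, p, fun _ => ⟨le_rfl, le_rfl⟩⟩
  have hw' : ∀ a b, w a b / p = w b a / p := fun a b => by rw [hw]
  have h1 := one_le_integral_edgeProd (w := fun a b => w a b / p) hw' (hpos.div hpp)
    (by simp only [integral_div]; exact div_self hppos.ne') hT h
  have hsc (x : V → I) : edgeProd (fun a b => w a b / p) hw' H x =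
      edgeProd w hw H x / p ^ H.edgeFinset.card := by
    unfold edgeProd
    rw [← Finset.prod_const, ← Finset.prod_div_distrib]
    refine Finset.prod_congr rfl fun e _ => ?_
    induction e with
    | h a b => rfl
  simp only [hsc] at h1
  rw [integral_div, le_div_iff₀ (pow_pos hppos _), one_mul] at h1
  exact h1

end Sidorenko

end ReflectionTree

open ReflectionTree Filter Topology in
/-- Every reflection tree is a Sidorenko graph: if `H` is obtained from a tree `T` by
applying reflection operations to a collection of subtrees of `T`, then
`t(H, W) ≥ (∫∫ W)^{|E(H)|}` for every bounded symmetric measurable `W : [0,1]² → ℝ≥0`. -/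
theorem reflectionTree_sidorenko (V₀ : Type) (T : SimpleGraph V₀) (htree : T.IsTree)
    {V : Type} [Fintype V] [DecidableEq V] (H : SimpleGraph V) (f : V₀ → V)
    (h : IsReflectionTree V₀ T V H f) : IsSidorenko H := by
  classical
  intro W hWm hW0 ⟨C, hC⟩ hsym
  have hbW : BddMeas (Function.uncurry W) :=
    ⟨hWm, C, fun p => (abs_of_nonneg (hW0 p.1 p.2)).trans_le (hC p.1 p.2)⟩
  have hWi : Integrable (fun a => ∫ b, W a b) :=
    (hbW.integrable (volume.prod volume)).integral_prod_left
  have hWib (a : I) : Integrable (W a) := (hbW.comp (τ := Prod.mk a) (by fun_prop)).integrable _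
  set p := ∫ a, ∫ b, W a b with hp
  have hp0 : 0 ≤ p := integral_nonneg fun a => integral_nonneg fun b => hW0 a b
  set ε : ℕ → ℝ := fun n => 1 / ((n : ℝ) + 1) with hε
  have hεpos (n : ℕ) : 0 < ε n := Nat.one_div_pos_of_nat
  have hε1 (n : ℕ) : ε n ≤ 1 := by
    rw [hε]
    exact div_le_one_of_le₀ (by simp) (by positivity)
  have hεlim : Tendsto ε atTop (𝓝 0) := tendsto_one_div_add_atTop_nhds_zero_nat
  have hsym' (n : ℕ) (a b : I) : W a b + ε n = W b a + ε n := by rw [hsym]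
  have hpos (n : ℕ) : BddPos (Function.uncurry fun a b => W a b + ε n) :=
    ⟨hWm.add_const _, ε n, hεpos n, C + ε n, fun q =>
      ⟨le_add_of_nonneg_left (hW0 _ _), add_le_add_left (hC _ _) _⟩⟩
  have hbound (n : ℕ) : p ^ H.edgeFinset.card ≤
      ∫ x, edgeProd (fun a b => W a b + ε n) (hsym' n) H x := by
    have := pow_le_integral_edgeProd (hsym' n) (hpos n) htree h
    have hpe : ∫ a, ∫ b, (W a b + ε n) = p + ε n := by
      have (a : I) : ∫ b, (W a b + ε n) = (∫ b, W a b) + ε n := by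
        rw [integral_add (hWib a) (integrable_const _)]
        simp
      simp only [this]
      rw [integral_add hWi (integrable_const _)]
      simp [hp]
    rw [hpe] at this
    exact (pow_le_pow_left₀ hp0 (le_add_of_nonneg_right (hεpos n).le) _).trans this
  have hlim : Tendsto (fun n => ∫ x, edgeProd (fun a b => W a b + ε n) (hsym' n) H x) atTop
      (𝓝 (∫ x, edgeProd W hsym H x)) := by
    refine tendsto_integral_of_dominated_convergence
      (fun _ => (C + 1) ^ H.edgeFinset.card)
      (fun n => (bddPos_edgeProd (hsym' n) (hpos n) H).1.aestronglyMeasurable)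
      (integrable_const _) (fun n => ae_of_all _ fun x => ?_) (ae_of_all _ fun x => ?_)
    · rw [Real.norm_of_nonneg ((bddPos_edgeProd (hsym' n) (hpos n) H).pos x).le,
        ← Finset.prod_const]
      refine Finset.prod_le_prod
        (fun e _ => ((bddPos_edgeWeight (hsym' n) (hpos n) e).pos x).le) fun e _ => ?_
      induction e with
      | h a b => exact add_le_add (hC _ _) (hε1 n)
    · refine tendsto_finsetProd _ fun e _ => ?_
      induction e with
      | h a b =>
        have := hεlim.const_add (W (x a) (x b))
        rwa [add_zero] at this
  have key := ge_of_tendsto' hlim hbound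
  simp only [edgeProd_eq] at key
  rw [ge_iff_le]
  convert! key
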